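/- arXiv:2208.00820 — 2 statements merged into one kernel-verified Lean document; each statement's English description precedes it below -/
import Mathlib

section
/- Let φ: ℝ → ℝ be measurable and suppose there exists a constant C > 0 such that |φ(y)| ≤ C(1 + |y|) for all y ∈ ℝ. For each natural number n ≥ 1 define φⁿ(x) = ∫_ℝ P_{1/n}(x − y) · max(min(φ(y), n), −n) dy. Then for all n ≥ 1 and all x ∈ ℝ, |φⁿ(x)| ≤ 2C(1 + |x|); that is, the family (φⁿ) has globally linear growth with a constant independent of n. -/
open Real MeasureTheory Filter Set

/-- The Gaussian heat kernel `P_t(x) = (2πt)^{-1/2} exp(-x²/(2t))`. -/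
noncomputable def heatP (t x : ℝ) : ℝ :=
  (Real.sqrt (2 * Real.pi * t))⁻¹ * Real.exp (-x ^ 2 / (2 * t))

/-- The smoothed truncation `φⁿ(x) = ∫_ℝ P_{1/n}(x - y) · ((φ(y) ∧ n) ∨ (-n)) dy`. -/
noncomputable def phiN (φ : ℝ → ℝ) (n : ℕ) (x : ℝ) : ℝ :=
  ∫ y : ℝ, heatP (1 / n) (x - y) * max (min (φ y) n) (-(n : ℝ))

open ProbabilityTheory in
lemma heatP_sub_eq_gaussianPDFReal (v : NNReal) (x y : ℝ) :
    heatP v (x - y) = gaussianPDFReal x v y := by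
  rw [heatP, gaussianPDFReal, ← neg_sub y x, neg_sq]

open ProbabilityTheory in
lemma integral_heatP_sub_mul {v : NNReal} (hv : v ≠ 0) (f : ℝ → ℝ) (x : ℝ) :
    ∫ y, heatP v (x - y) * f y = ∫ y, f y ∂gaussianReal x v := by
  simp_rw [integral_gaussianReal_eq_integral_smul hv, heatP_sub_eq_gaussianPDFReal, smul_eq_mul]

open ProbabilityTheory in
lemma integrable_sub_sq_gaussianReal (x : ℝ) (v : NNReal) :
    Integrable (fun y ↦ (y - x) ^ 2) (gaussianReal x v) :=
  ((memLp_id_gaussianReal 2).sub (memLp_const x)).integrable_sq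

open ProbabilityTheory in
lemma integral_sub_sq_gaussianReal (x : ℝ) (v : NNReal) :
    ∫ y, (y - x) ^ 2 ∂gaussianReal x v = v := by
  rw [← variance_fun_id_gaussianReal (μ := x) (v := v), variance_eq_integral aemeasurable_id',
    integral_id_gaussianReal]

open ProbabilityTheory in
/-- A function of linear growth has Gaussian means of linear growth. -/
lemma abs_integral_gaussianReal_le_of_linear_growth {f : ℝ → ℝ} {C : ℝ} (hC : 0 ≤ C)
    (hf : ∀ y, |f y| ≤ C * (1 + |y|)) (x : ℝ) (v : NNReal) :
    |∫ y, f y ∂gaussianReal x v| ≤ C * (1 + |x| + (1 + v) / 2) := by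
  have hint := integrable_sub_sq_gaussianReal x v
  have hbound : ∀ y, ‖f y‖ ≤ C * (1 + |x| + 1 / 2) + C / 2 * (y - x) ^ 2 := fun y ↦ by
    have hy : |y| ≤ |x| + |y - x| := by simpa using abs_add_le x (y - x)
    have hsq : |y - x| ≤ (1 + (y - x) ^ 2) / 2 := by
      nlinarith [sq_nonneg (|y - x| - 1), sq_abs (y - x)]
    calc ‖f y‖ ≤ C * (1 + |y|) := hf y
      _ ≤ C * (1 + (|x| + (1 + (y - x) ^ 2) / 2)) := by gcongr; linarith
      _ = _ := by ring
  calc |∫ y, f y ∂gaussianReal x v|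
      ≤ ∫ y, C * (1 + |x| + 1 / 2) + C / 2 * (y - x) ^ 2 ∂gaussianReal x v :=
        norm_integral_le_of_norm_le ((integrable_const _).add (hint.const_mul _))
          (.of_forall hbound)
    _ = C * (1 + |x| + 1 / 2) + C / 2 * v := by
        rw [integral_add (integrable_const _) (hint.const_mul _), integral_const_mul (C / 2),
          integral_sub_sq_gaussianReal]
        simp
    _ = _ := by ring

lemma abs_max_min_neg_le {a b : ℝ} (hb : 0 ≤ b) : |max (min a b) (-b)| ≤ |a| := by
  refine abs_le.2 ⟨?_, max_le ((min_le_left _ _).trans (le_abs_self a)) ?_⟩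
  · rcases le_total a b with h | h
    · exact (neg_abs_le a).trans (by simp [h])
    · exact le_max_of_le_left (le_min (neg_abs_le a) (by linarith [abs_nonneg a]))
  · linarith [abs_nonneg a]

/-- If `φ` is measurable with `|φ(y)| ≤ C(1 + |y|)`, then the family `(φⁿ)` has a common
globally linear growth bound `|φⁿ(x)| ≤ 2C(1 + |x|)`. -/
theorem phiN_linear_growth (φ : ℝ → ℝ) (hφ : Measurable φ) (C : ℝ) (hC : 0 < C)
    (hgrowth : ∀ y : ℝ, |φ y| ≤ C * (1 + |y|)) :
    ∀ n : ℕ, 1 ≤ n → ∀ x : ℝ, |phiN φ n x| ≤ 2 * C * (1 + |x|) := by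
  intro n hn x
  have hn' : (1 : ℝ) ≤ n := mod_cast hn
  have hv : (1 / n : NNReal) ≠ 0 := by positivity
  have hv1 : (1 / n : ℝ) ≤ 1 := by rw [div_le_one (by linarith)]; exact hn'
  have hphi := integral_heatP_sub_mul hv (fun y ↦ max (min (φ y) n) (-(n : ℝ))) x
  have hmean := abs_integral_gaussianReal_le_of_linear_growth hC.le
    (fun y ↦ (abs_max_min_neg_le n.cast_nonneg).trans (hgrowth y)) x (1 / n : NNReal)
  rw [← hphi] at hmean
  push_cast at hmean
  calc |phiN φ n x| ≤ C * (1 + |x| + (1 + 1 / n) / 2) := hmean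
    _ ≤ C * (2 * (1 + |x|)) := by gcongr; linarith [abs_nonneg x]
    _ = _ := by ring
end

section
/- Let L > 0, let G_t(x, y) be the Dirichlet heat kernel on [0, L], and let p ≥ 1 be a real number. Then there exists a constant C > 0 (depending only on p and L) such that for every t > 0 and every x ∈ [0, L], ∫₀^L |G_t(x, y)|^p dy ≤ C · t^{−(p−1)/2}. -/
open Real MeasureTheory Filter Set

/-- The Dirichlet heat kernel on `[0, L]`:
`G_t(x,y) = (2πt)^{-1/2} Σ_{k∈ℤ} [exp(-(y-x+2kL)²/(2t)) - exp(-(y+x+2kL)²/(2t))]`. -/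
noncomputable def heatG (L t x y : ℝ) : ℝ :=
  (Real.sqrt (2 * Real.pi * t))⁻¹ *
    ∑' k : ℤ, (Real.exp (-(y - x + 2 * (k : ℝ) * L) ^ 2 / (2 * t)) -
      Real.exp (-(y + x + 2 * (k : ℝ) * L) ^ 2 / (2 * t)))

/-- The decrements of an antitone real sequence tending to zero sum to its first term. -/
lemma hasSum_sub_succ_of_tendsto_zero {F : ℕ → ℝ} (hF : Tendsto F atTop (nhds 0))
    (h : ∀ n, 0 ≤ F n - F (n + 1)) : HasSum (fun n => F n - F (n + 1)) (F 0) := by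
  rw [hasSum_iff_tendsto_nat_of_nonneg h]
  simp only [Finset.sum_range_sub']
  simpa using hF.const_sub (F 0)

/-- A sum over `ℤ` is bounded by telescoping majorants of its positive and negative parts. -/
lemma abs_tsum_int_le_of_telescoping {u : ℤ → ℝ} {F H : ℕ → ℝ} {M : ℝ}
    (hF : Tendsto F atTop (nhds 0)) (hH : Tendsto H atTop (nhds 0)) (hM : |u 0| ≤ M)
    (hpos : ∀ n : ℕ, |u (n + 1)| ≤ F n - F (n + 1))
    (hneg : ∀ n : ℕ, |u (-(n + 1))| ≤ H n - H (n + 1)) :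
    |∑' k, u k| ≤ M + F 0 + H 0 := by
  have hF' := hasSum_sub_succ_of_tendsto_zero hF fun n => (abs_nonneg _).trans (hpos n)
  have hH' := hasSum_sub_succ_of_tendsto_zero hH fun n => (abs_nonneg _).trans (hneg n)
  let g : ℤ → ℝ := fun k => Int.casesOn k
    (fun n => Nat.casesOn n M fun m => F m - F (m + 1)) fun n => H n - H (n + 1)
  have hg₀ : HasSum (fun n : ℕ => g n) (M + F 0) := HasSum.zero_add (f := fun n : ℕ => g n) hF'
  have hg : HasSum g (M + F 0 + H 0) := by
    refine HasSum.of_nat_of_neg_add_one hg₀ ?_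
    convert hH' using 2 with n
    rw [← Int.negSucc_eq]
  rw [← Real.norm_eq_abs]
  refine tsum_of_norm_bounded hg fun k => ?_
  rw [Real.norm_eq_abs]
  rcases k with n | n
  · rcases n with _ | n
    · exact hM
    · exact hpos n
  · have := hneg n
    rwa [← Int.negSucc_eq] at this

lemma exp_neg_sq_div_le {t u v : ℝ} (ht : 0 < t) (h : |v| ≤ |u|) :
    exp (-u ^ 2 / (2 * t)) ≤ exp (-v ^ 2 / (2 * t)) := by
  have := sq_le_sq.2 h
  gcongr

lemma tendsto_exp_neg_sq_div {t L : ℝ} (ht : 0 < t) (hL : 0 < L) (c : ℝ) :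
    Tendsto (fun n : ℕ => exp (-(c + 2 * ((n : ℝ) + 1) * L) ^ 2 / (2 * t))) atTop (nhds 0) := by
  have h1 : Tendsto (fun n : ℕ => c + 2 * ((n : ℝ) + 1) * L) atTop atTop := by
    refine tendsto_atTop_add_const_left _ _ (Tendsto.atTop_mul_const hL ?_)
    exact Tendsto.const_mul_atTop two_pos
      (tendsto_atTop_add_const_right _ _ tendsto_natCast_atTop_atTop)
  have h2 := ((tendsto_pow_atTop two_ne_zero).comp h1).atTop_div_const (mul_pos two_pos ht)
  refine (tendsto_exp_atBot.comp (tendsto_neg_atTop_atBot.comp h2)).congr fun n => ?_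
  simp [neg_div]

/-- Gaussian upper bound for the Dirichlet heat kernel, uniform in time. -/
lemma abs_heatG_le {L t x y : ℝ} (hL : 0 < L) (ht : 0 < t)
    (hx : x ∈ Icc 0 L) (hy : y ∈ Icc 0 L) :
    |heatG L t x y| ≤ (√(2 * π * t))⁻¹ * (3 * exp (-(y - x) ^ 2 / (2 * t))) := by
  obtain ⟨hx0, hxL⟩ := hx
  obtain ⟨hy0, hyL⟩ := hy
  rw [heatG, abs_mul, abs_of_nonneg (by positivity : 0 ≤ (√(2 * π * t))⁻¹)]
  gcongr
  have key := abs_tsum_int_le_of_telescoping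
    (u := fun k : ℤ => exp (-(y - x + 2 * (k : ℝ) * L) ^ 2 / (2 * t)) -
      exp (-(y + x + 2 * (k : ℝ) * L) ^ 2 / (2 * t)))
    (M := exp (-(y - x) ^ 2 / (2 * t)))
    (tendsto_exp_neg_sq_div ht hL (y - x)) (tendsto_exp_neg_sq_div ht hL (-(y + x)))
    ?_ ?_ ?_
  · have h1 : exp (-(y - x + 2 * (((0 : ℕ) : ℝ) + 1) * L) ^ 2 / (2 * t)) ≤
        exp (-(y - x) ^ 2 / (2 * t)) := by
      apply exp_neg_sq_div_le ht
      push_cast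
      rw [abs_le, abs_of_nonneg (by linarith)]
      constructor <;> linarith
    have h2 : exp (-(-(y + x) + 2 * (((0 : ℕ) : ℝ) + 1) * L) ^ 2 / (2 * t)) ≤
        exp (-(y - x) ^ 2 / (2 * t)) := by
      apply exp_neg_sq_div_le ht
      push_cast
      rw [abs_le, abs_of_nonneg (by linarith)]
      constructor <;> linarith
    linarith
  · have h : exp (-(y + x) ^ 2 / (2 * t)) ≤ exp (-(y - x) ^ 2 / (2 * t)) := by
      apply exp_neg_sq_div_le ht
      rw [abs_le, abs_of_nonneg (by linarith)]
      constructor <;> linarith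
    have h' := exp_pos (-(y + x) ^ 2 / (2 * t))
    simp only [Int.cast_zero, mul_zero, zero_mul, add_zero]
    rw [abs_of_nonneg (by linarith)]
    linarith
  · intro n
    have hn : 0 ≤ (n : ℝ) * L := by positivity
    push_cast
    have h1 : exp (-(y + x + 2 * ((n : ℝ) + 1) * L) ^ 2 / (2 * t)) ≤
        exp (-(y - x + 2 * ((n : ℝ) + 1) * L) ^ 2 / (2 * t)) := by
      apply exp_neg_sq_div_le ht
      rw [abs_of_nonneg (by linarith), abs_of_nonneg (by linarith)]
      linarith
    have h2 : exp (-(y - x + 2 * ((n : ℝ) + 1 + 1) * L) ^ 2 / (2 * t)) ≤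
        exp (-(y + x + 2 * ((n : ℝ) + 1) * L) ^ 2 / (2 * t)) := by
      apply exp_neg_sq_div_le ht
      rw [abs_of_nonneg (by linarith), abs_of_nonneg (by linarith)]
      linarith
    rw [abs_of_nonneg (by linarith)]
    linarith
  · intro n
    have hn : 0 ≤ (n : ℝ) * L := by positivity
    push_cast
    have h1 : exp (-(y - x + 2 * (-((n : ℝ) + 1)) * L) ^ 2 / (2 * t)) ≤
        exp (-(y + x + 2 * (-((n : ℝ) + 1)) * L) ^ 2 / (2 * t)) := by
      apply exp_neg_sq_div_le ht
      rw [abs_of_nonpos (by linarith), abs_of_nonpos (by linarith)]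
      linarith
    have h2 : exp (-(-(y + x) + 2 * ((n : ℝ) + 1 + 1) * L) ^ 2 / (2 * t)) ≤
        exp (-(y - x + 2 * (-((n : ℝ) + 1)) * L) ^ 2 / (2 * t)) := by
      apply exp_neg_sq_div_le ht
      rw [abs_of_nonpos (by linarith), abs_of_nonneg (by linarith)]
      linarith
    have h3 : (-(y + x) + 2 * ((n : ℝ) + 1) * L) ^ 2 =
        (y + x + 2 * (-((n : ℝ) + 1)) * L) ^ 2 := by ring
    rw [abs_of_nonpos (by linarith), h3]
    linarith

/-- `Lᵖ` bound on the Dirichlet heat kernel: for `p ≥ 1` there exists `C > 0` with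
`∫₀^L |G_t(x,y)|^p dy ≤ C t^{-(p-1)/2}` for all `t > 0` and `x ∈ [0, L]`. -/
theorem heatG_Lp_bound (L : ℝ) (hL : 0 < L) (p : ℝ) (hp : 1 ≤ p) :
    ∃ C : ℝ, 0 < C ∧ ∀ t : ℝ, 0 < t → ∀ x ∈ Set.Icc (0 : ℝ) L,
      (∫ y in Set.Icc (0 : ℝ) L, |heatG L t x y| ^ p) ≤ C * t ^ (-(p - 1) / 2) := by
  have hp0 : 0 < p := by linarith
  refine ⟨(√(2 * π))⁻¹ ^ p * 3 ^ p * √(2 * π / p), by positivity, fun t ht x hx => ?_⟩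
  have hb : 0 < p / (2 * t) := by positivity
  let g : ℝ → ℝ := fun y => ((√(2 * π * t))⁻¹ ^ p * 3 ^ p) * exp (-(p / (2 * t)) * (y - x) ^ 2)
  have hg : Integrable g :=
    ((integrable_exp_neg_mul_sq hb).comp_sub_right x).const_mul _
  have hg0 : 0 ≤ g := fun y => by positivity
  have hle : ∀ y ∈ Icc 0 L, |heatG L t x y| ^ p ≤ g y := by
    intro y hy
    refine (rpow_le_rpow (abs_nonneg _) (abs_heatG_le hL ht hx hy) hp0.le).trans_eq ?_
    rw [mul_rpow (by positivity) (by positivity), mul_rpow (by positivity) (by positivity),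
      ← exp_mul, ← mul_assoc]
    simp only [g]
    congr 2
    ring
  calc ∫ y in Icc 0 L, |heatG L t x y| ^ p
      ≤ ∫ y in Icc 0 L, g y := by
        refine integral_mono_of_nonneg (ae_of_all _ fun y => by positivity) hg.integrableOn ?_
        exact (ae_restrict_iff' measurableSet_Icc).2 (ae_of_all _ hle)
    _ ≤ ∫ y, g y := setIntegral_le_integral hg (ae_of_all _ hg0)
    _ = ((√(2 * π * t))⁻¹ ^ p * 3 ^ p) * √(π / (p / (2 * t))) := by
        simp only [g]
        rw [integral_const_mul, integral_sub_right_eq_self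
          (fun y => exp (-(p / (2 * t)) * y ^ 2)) x, integral_gaussian]
    _ = _ := by
        have h1 : π / (p / (2 * t)) = 2 * π / p * t := by field_simp
        have h2 : (√t)⁻¹ ^ p * √t = t ^ (-(p - 1) / 2) := by
          rw [sqrt_eq_rpow, ← rpow_neg ht.le, ← rpow_mul ht.le, ← rpow_add ht]
          congr 1
          ring
        rw [h1, sqrt_mul (by positivity) t, sqrt_mul (by positivity) t, mul_inv,
          mul_rpow (by positivity) (by positivity), ← h2]
        ring
end
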